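/- Let 𝕋² = (ℝ/ℤ)² be the flat torus with its quotient metric d and Haar probability measure, and for L ≥ 1 let E_L ⊆ L²(𝕋²) be the linear span of the characters e_{n,m}(x, y) = exp(2πi(nx + my)) over pairs (n, m) ∈ ℤ² with 4π²(n² + m²) ≤ L², with k_L = dim E_L. Let Z = {Z(L)}_{L≥1}, Z(L) = {z_{L1}, …, z_{Lm_L}} ⊂ 𝕋², be a triangular family with m_L ≤ k_L which is an L²-interpolating family: for every array of values c_{Lj} (1 ≤ j ≤ m_L, L ≥ 1) with sup_L k_L^{-1} Σ_{j=1}^{m_L} |c_{Lj}|² < ∞, there exist f_L ∈ E_L with sup_L ‖f_L‖_{L²(𝕋²)} < ∞ and f_L(z_{Lj}) = c_{Lj} for all j and L. Then Z is uniformly separated, and its upper Beurling–Landau density satisfies D⁺(Z) ≤ 1, where D⁺(Z) = limsup_{R→∞} limsup_{L→∞} max_{ξ∈𝕋²} [k_L^{-1} #(Z(L) ∩ B(ξ, R/L))] / vol(B(ξ, R/L)). -/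

import Mathlib

open MeasureTheory Filter

noncomputable section

/-- The flat torus `𝕋² = (ℝ/ℤ)²`, with its product (quotient) metric and Haar
probability measure. -/
abbrev T2 := AddCircle (1 : ℝ) × AddCircle (1 : ℝ)

/-- The character `e_{n,m}(x,y) = exp(2πi(nx+my))` on `𝕋²`. -/
noncomputable def eChar (n m : ℤ) : T2 → ℂ := fun p => fourier n p.1 * fourier m p.2

/-- `E_L`: the span of the characters `e_{n,m}` with `4π²(n²+m²) ≤ L²`,
i.e. of the eigenfunctions of the Laplacian on `𝕋²` with eigenvalue at most `L²`. -/
noncomputable def EL (L : ℝ) : Submodule ℂ (T2 → ℂ) :=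
  Submodule.span ℂ {f | ∃ n m : ℤ,
    4 * Real.pi ^ 2 * ((n : ℝ) ^ 2 + (m : ℝ) ^ 2) ≤ L ^ 2 ∧ f = eChar n m}

/-- `k_L = dim E_L`. -/
noncomputable def kL (L : ℝ) : ℕ := Module.finrank ℂ (EL L)

open ComplexConjugate

section CircleCharacters

theorem exists_coe_abs_eq_norm (x : AddCircle (1 : ℝ)) :
    ∃ t : ℝ, (t : AddCircle (1 : ℝ)) = x ∧ |t| = ‖x‖ ∧ |t| ≤ 1 / 2 := by
  induction x using QuotientAddGroup.induction_on with
  | H y =>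
    refine ⟨y - round y, ?_, ?_, abs_sub_round y⟩
    · have h : ((round y : ℝ) : AddCircle (1 : ℝ)) = 0 :=
        AddCircle.coe_eq_zero_iff (1 : ℝ) |>.2 ⟨round y, by simp⟩
      rw [AddCircle.coe_sub, h, sub_zero]
    · exact (UnitAddCircle.norm_eq (x := y)).symm

theorem fourier_coe_eq_exp (n : ℤ) (t : ℝ) :
    fourier n (t : AddCircle (1 : ℝ)) = Complex.exp (Complex.I * ((2 * Real.pi * n * t : ℝ) : ℂ)) := by
  rw [fourier_coe_apply]
  congr 1
  push_cast
  ring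

theorem norm_fourier_apply (n : ℤ) (x : AddCircle (1 : ℝ)) : ‖fourier n x‖ = 1 := by
  rw [fourier_apply]; exact Circle.norm_coe _

theorem norm_fourier_sub_one_le (n : ℤ) (x : AddCircle (1 : ℝ)) :
    ‖fourier n x - 1‖ ≤ 2 * Real.pi * |(n : ℝ)| * ‖x‖ := by
  obtain ⟨t, rfl, ht, -⟩ := exists_coe_abs_eq_norm x
  rw [fourier_coe_eq_exp, ← ht]
  refine Real.norm_exp_I_mul_ofReal_sub_one_le.trans_eq ?_
  rw [Real.norm_eq_abs, abs_mul, abs_mul, abs_of_pos Real.two_pi_pos]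

theorem le_norm_fourier_one_sub_one (x : AddCircle (1 : ℝ)) :
    4 * ‖x‖ ≤ ‖fourier 1 x - 1‖ := by
  obtain ⟨t, rfl, ht, ht2⟩ := exists_coe_abs_eq_norm x
  rw [fourier_coe_eq_exp, ← ht, Complex.norm_exp_I_mul_ofReal_sub_one, norm_mul,
    Real.norm_eq_abs, Real.norm_eq_abs]
  have e : 2 * Real.pi * ((1 : ℤ) : ℝ) * t / 2 = Real.pi * t := by push_cast; ring
  have hpi := Real.pi_pos
  have h := Real.mul_abs_le_abs_sin (x := Real.pi * t) (by
    rw [abs_mul, abs_of_pos hpi]; nlinarith)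
  rw [abs_mul, abs_of_pos hpi] at h
  have e2 : 2 / Real.pi * (Real.pi * |t|) = 2 * |t| := by field_simp
  rw [e, abs_two]
  linarith

theorem fourier_natCast (h : ℕ) (x : AddCircle (1 : ℝ)) :
    fourier (h : ℤ) x = fourier 1 x ^ h := by
  induction h with
  | zero => simp
  | succ k ih => rw [Nat.cast_succ, fourier_add, ih, pow_succ]

theorem normSq_fourier_sub_one (n : ℤ) (x : AddCircle (1 : ℝ)) :
    ‖fourier n x - 1‖ ^ 2 = 2 - 2 * (fourier n x).re := by
  have h := norm_fourier_apply n x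
  have h2 : ‖fourier n x‖ ^ 2 = 1 := by rw [h]; norm_num
  rw [← Complex.normSq_eq_norm_sq, Complex.normSq_apply] at *
  simp only [Complex.sub_re, Complex.sub_im, Complex.one_re, Complex.one_im]
  linarith

/-- Averaging `|e_h - 1|²` over the frequencies `1, …, H` gives at least `1` away from the
`1/H`-neighbourhood of the origin. -/
theorem le_sum_normSq_fourier_sub_one {H : ℕ} {x : AddCircle (1 : ℝ)} (hx : 1 ≤ H * ‖x‖) :
    (H : ℝ) ≤ ∑ h ∈ Finset.range H, ‖fourier ((h + 1 : ℕ) : ℤ) x - 1‖ ^ 2 := by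
  have hx0 : 0 < ‖x‖ := by
    by_contra h0
    have := norm_nonneg x
    have h1 : ‖x‖ = 0 := by linarith
    rw [h1] at hx
    norm_num at hx
  set q : ℂ := fourier 1 x with hq
  have hq1 : ‖q‖ = 1 := norm_fourier_apply 1 x
  have hgeom : ‖∑ h ∈ Finset.range H, q ^ (h + 1)‖ ≤ H / 2 := by
    have e : (∑ h ∈ Finset.range H, q ^ (h + 1)) * (q - 1) = (q ^ H - 1) * q := by
      rw [← geom_sum_mul, Finset.sum_mul, Finset.sum_mul, Finset.sum_mul]
      exact Finset.sum_congr rfl fun i _ => by ring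
    have e2 := congrArg norm e
    rw [norm_mul, norm_mul, hq1, mul_one] at e2
    have h3 : ‖q ^ H - 1‖ ≤ 2 := by
      refine (norm_sub_le _ _).trans ?_
      rw [norm_pow, hq1]; norm_num
    have h4 := le_norm_fourier_one_sub_one x
    rw [← hq] at h4
    have h5 : ‖∑ h ∈ Finset.range H, q ^ (h + 1)‖ * (4 * ‖x‖) ≤ 2 := by
      calc _ ≤ ‖∑ h ∈ Finset.range H, q ^ (h + 1)‖ * ‖q - 1‖ := by gcongr
        _ ≤ 2 := e2.trans_le h3
    have h6 : ‖∑ h ∈ Finset.range H, q ^ (h + 1)‖ * (4 * ‖x‖) ≤ H / 2 * (4 * ‖x‖) := by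
      linarith
    exact le_of_mul_le_mul_right h6 (by positivity)
  have hre := (Complex.re_le_norm (∑ h ∈ Finset.range H, q ^ (h + 1))).trans hgeom
  rw [Complex.re_sum] at hre
  simp_rw [normSq_fourier_sub_one, fourier_natCast]
  rw [Finset.sum_sub_distrib, ← Finset.mul_sum, Finset.sum_const, Finset.card_range, nsmul_eq_mul]
  linarith

theorem integral_fourier (n : ℤ) :
    ∫ x : AddCircle (1 : ℝ), fourier n x = if n = 0 then 1 else 0 := by
  split_ifs with h
  · subst h; simp [Measure.real]
  · have hc : ∀ y : AddCircle (1 : ℝ), fourier n (y + ((1 / 2 / n : ℝ) : AddCircle (1 : ℝ)))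
        = - fourier n y := fun y => fourier_add_half_inv_index h one_pos y
    have := integral_add_right_eq_self (μ := (volume : Measure (AddCircle (1 : ℝ))))
      (fun y => (fourier n y : ℂ)) ((1 / 2 / n : ℝ) : AddCircle (1 : ℝ))
    simp only [hc, integral_neg] at this
    have h2 : (2 : ℂ) * ∫ x : AddCircle (1 : ℝ), fourier n x = 0 := by linear_combination -this
    simpa using h2

end CircleCharacters

section TorusCharacters

theorem continuous_eChar (n m : ℤ) : Continuous (eChar n m) := by
  unfold eChar; fun_prop

theorem norm_eChar (n m : ℤ) (x : T2) : ‖eChar n m x‖ = 1 := by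
  rw [eChar, norm_mul, norm_fourier_apply, norm_fourier_apply, one_mul]

theorem eChar_add_index (n m n' m' : ℤ) (x : T2) :
    eChar (n + n') (m + m') x = eChar n m x * eChar n' m' x := by
  simp only [eChar, fourier_add]; ring

theorem conj_eChar (n m : ℤ) (x : T2) : conj (eChar n m x) = eChar (-n) (-m) x := by
  simp only [eChar, fourier_neg, map_mul]

theorem fourier_sub_apply (n : ℤ) (x y : AddCircle (1 : ℝ)) :
    fourier n (x - y) = fourier n x * conj (fourier n y) := by
  rw [← fourier_neg, fourier_apply, fourier_apply, fourier_apply, smul_sub, sub_eq_add_neg,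
    AddCircle.toCircle_add, neg_smul, Circle.coe_mul]

theorem eChar_sub (n m : ℤ) (x y : T2) :
    eChar n m (x - y) = eChar n m x * conj (eChar n m y) := by
  simp only [eChar, Prod.fst_sub, Prod.snd_sub, fourier_sub_apply, map_mul]; ring

theorem integral_eChar (n m : ℤ) :
    ∫ x : T2, eChar n m x = if n = 0 ∧ m = 0 then 1 else 0 := by
  have := integral_prod_mul (μ := (volume : Measure (AddCircle (1 : ℝ))))
    (ν := (volume : Measure (AddCircle (1 : ℝ)))) (fun x => (fourier n x : ℂ))
    (fun x => (fourier m x : ℂ))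
  rw [integral_fourier, integral_fourier] at this
  rw [Measure.volume_eq_prod]
  refine this.trans ?_
  split_ifs <;> simp_all

theorem norm_eChar_sub_eChar_le (n m : ℤ) (x y : T2) :
    ‖eChar n m x - eChar n m y‖ ≤ 2 * Real.pi * (|(n : ℝ)| + |(m : ℝ)|) * dist x y := by
  have h1 : eChar n m x - eChar n m y = (eChar n m (x - y) - 1) * eChar n m y := by
    rw [eChar_sub, sub_mul, mul_assoc, mul_comm (conj _), Complex.mul_conj,
      Complex.normSq_eq_norm_sq, norm_eChar]
    simp
  rw [h1, norm_mul, norm_eChar, mul_one, dist_eq_norm]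
  set w := x - y
  have h2 : eChar n m w - 1 = (fourier n w.1 - 1) * fourier m w.2 + (fourier m w.2 - 1) := by
    simp only [eChar]; ring
  rw [h2]
  refine (norm_add_le _ _).trans ?_
  rw [norm_mul, norm_fourier_apply, mul_one]
  have ha := norm_fourier_sub_one_le n w.1
  have hb := norm_fourier_sub_one_le m w.2
  have ha' : 2 * Real.pi * |(n : ℝ)| * ‖w.1‖ ≤ 2 * Real.pi * |(n : ℝ)| * ‖w‖ := by
    gcongr; exact norm_fst_le w
  have hb' : 2 * Real.pi * |(m : ℝ)| * ‖w.2‖ ≤ 2 * Real.pi * |(m : ℝ)| * ‖w‖ := by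
    gcongr; exact norm_snd_le w
  linarith

theorem Continuous.integrable_T2 {E : Type*} [NormedAddCommGroup E] {f : T2 → E}
    (hf : Continuous f) : Integrable f :=
  hf.integrable_of_hasCompactSupport (HasCompactSupport.of_compactSpace f)

/-- Parseval's identity for trigonometric polynomials on the torus. -/
theorem integral_normSq_sum_eChar (S : Finset (ℤ × ℤ)) (a : ℤ × ℤ → ℂ) :
    ∫ x : T2, ‖∑ p ∈ S, a p * eChar p.1 p.2 x‖ ^ 2 = ∑ p ∈ S, ‖a p‖ ^ 2 := by
  have h1 : ∀ x : T2, ((‖∑ p ∈ S, a p * eChar p.1 p.2 x‖ ^ 2 : ℝ) : ℂ) =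
      ∑ p ∈ S, ∑ q ∈ S, (a p * conj (a q)) * eChar (p.1 + -q.1) (p.2 + -q.2) x := by
    intro x
    rw [← Complex.normSq_eq_norm_sq, ← Complex.mul_conj, map_sum, Finset.sum_mul_sum]
    refine Finset.sum_congr rfl fun p _ => Finset.sum_congr rfl fun q _ => ?_
    rw [map_mul, conj_eChar, eChar_add_index]; ring
  have hc : ∀ (c : ℂ) (n m : ℤ), Integrable (fun x : T2 => c * eChar n m x) := fun c n m =>
    (continuous_const.mul (continuous_eChar n m)).integrable_T2
  have h2 : ((∫ x : T2, ‖∑ p ∈ S, a p * eChar p.1 p.2 x‖ ^ 2 : ℝ) : ℂ) =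
      ((∑ p ∈ S, ‖a p‖ ^ 2 : ℝ) : ℂ) := by
    rw [← integral_complex_ofReal]
    simp_rw [h1]
    rw [integral_finsetSum _ fun p _ => integrable_finsetSum _ fun q _ => hc _ _ _]
    push_cast
    refine Finset.sum_congr rfl fun p hp => ?_
    rw [integral_finsetSum _ fun q _ => hc _ _ _, Finset.sum_eq_single p]
    · rw [integral_const_mul, integral_eChar]
      simp [Complex.mul_conj, Complex.normSq_eq_norm_sq]
    · intro q _ hqp
      rw [integral_const_mul, integral_eChar, if_neg, mul_zero]
      rintro ⟨h, h'⟩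
      exact hqp (Prod.ext (by omega) (by omega))
    · exact fun h => absurd hp h
  exact_mod_cast h2

end TorusCharacters

section Frequencies

theorem finite_frequencies (L : ℝ) :
    {p : ℤ × ℤ | 4 * Real.pi ^ 2 * ((p.1 : ℝ) ^ 2 + (p.2 : ℝ) ^ 2) ≤ L ^ 2}.Finite := by
  refine (((Set.finite_Icc (-⌈|L|⌉) ⌈|L|⌉).prod (Set.finite_Icc (-⌈|L|⌉) ⌈|L|⌉))).subset ?_
  rintro ⟨n, m⟩ h
  simp only [Set.mem_ofPred_eq] at h
  have hpi := Real.pi_gt_three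
  have key : ∀ a b : ℤ, 4 * Real.pi ^ 2 * ((a : ℝ) ^ 2 + (b : ℝ) ^ 2) ≤ L ^ 2 →
      a ∈ Set.Icc (-⌈|L|⌉) ⌈|L|⌉ := by
    intro a b hab
    have h1 : (a : ℝ) ^ 2 ≤ L ^ 2 := by
      have h4 : 1 ≤ 4 * Real.pi ^ 2 := by nlinarith
      nlinarith [sq_nonneg (a : ℝ), sq_nonneg (b : ℝ)]
    have h2 : |(a : ℝ)| ≤ |L| := sq_le_sq.1 h1
    have h3 := abs_le.1 (h2.trans (Int.le_ceil |L|))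
    exact ⟨by exact_mod_cast h3.1, by exact_mod_cast h3.2⟩
  exact ⟨key n m h, key m n (by rwa [add_comm])⟩

/-- The frequencies `(n, m)` of the characters spanning `E_L`. -/
def freq (L : ℝ) : Finset (ℤ × ℤ) := (finite_frequencies L).toFinset

theorem mem_freq {L : ℝ} {p : ℤ × ℤ} :
    p ∈ freq L ↔ 4 * Real.pi ^ 2 * ((p.1 : ℝ) ^ 2 + (p.2 : ℝ) ^ 2) ≤ L ^ 2 := by
  simp [freq]

theorem swap_mem_freq {L : ℝ} {p : ℤ × ℤ} : p.swap ∈ freq L ↔ p ∈ freq L := by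
  rw [mem_freq, mem_freq, Prod.fst_swap, Prod.snd_swap, add_comm]

theorem abs_snd_le_of_mem_freq {L : ℝ} (hL : 0 ≤ L) {p : ℤ × ℤ} (hp : p ∈ freq L) :
    2 * Real.pi * |(p.2 : ℝ)| ≤ L := by
  rw [mem_freq] at hp
  have hpi := Real.pi_pos
  refine abs_le_of_sq_le_sq' ?_ hL |>.2
  rw [mul_pow, mul_pow, sq_abs]
  nlinarith [mul_nonneg (sq_nonneg Real.pi) (sq_nonneg (p.1 : ℝ))]

theorem abs_fst_le_of_mem_freq {L : ℝ} (hL : 0 ≤ L) {p : ℤ × ℤ} (hp : p ∈ freq L) :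
    2 * Real.pi * |(p.1 : ℝ)| ≤ L :=
  abs_snd_le_of_mem_freq hL (swap_mem_freq.2 hp)

theorem linearIndependent_eChar :
    LinearIndependent ℂ (fun p : ℤ × ℤ => eChar p.1 p.2) := by
  rw [linearIndependent_iff']
  intro S a h p hp
  have h1 := integral_normSq_sum_eChar S a
  have h2 : ∀ x, ∑ p ∈ S, a p * eChar p.1 p.2 x = 0 := fun x => by
    simpa using congrFun h x
  simp only [h2, norm_zero, ne_eq, OfNat.ofNat_ne_zero, not_false_eq_true, zero_pow,
    integral_zero] at h1
  have := (Finset.sum_eq_zero_iff_of_nonneg fun p _ => sq_nonneg ‖a p‖).1 h1.symm p hp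
  simpa using this

theorem EL_eq_span_image (L : ℝ) :
    EL L = Submodule.span ℂ ((fun p : ℤ × ℤ => eChar p.1 p.2) '' (freq L : Set (ℤ × ℤ))) := by
  rw [EL]
  congr 1
  ext f
  constructor
  · rintro ⟨n, m, h, rfl⟩
    exact ⟨(n, m), mem_freq.2 h, rfl⟩
  · rintro ⟨p, hp, rfl⟩
    exact ⟨p.1, p.2, mem_freq.1 hp, rfl⟩

theorem kL_eq_card (L : ℝ) : kL L = (freq L).card := by
  classical
  rw [kL, EL_eq_span_image, ← Finset.coe_image, finrank_span_finset_eq_card,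
    Finset.card_image_of_injective _ linearIndependent_eChar.injective]
  rw [Finset.coe_image]
  exact (linearIndependent_eChar.linearIndepOn_id).mono (Set.image_subset_range _ _)

theorem mem_EL_iff {L : ℝ} {f : T2 → ℂ} :
    f ∈ EL L ↔ ∃ a : ℤ × ℤ → ℂ, f = fun x => ∑ p ∈ freq L, a p * eChar p.1 p.2 x := by
  rw [EL_eq_span_image, Submodule.mem_span_image_finset_iff_exists_fun']
  refine exists_congr fun a => ?_
  rw [eq_comm, funext_iff, funext_iff]
  simp

theorem le_card_freq {L : ℝ} (hL : 0 ≤ L) : L ^ 2 / 100 ≤ (freq L).card := by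
  have hpi := Real.pi_lt_d2
  have hpi0 := Real.pi_pos
  set M : ℕ := ⌊L / 10⌋₊ with hM
  have hM1 : (M : ℝ) ≤ L / 10 := Nat.floor_le (by positivity)
  have hM2 : L / 10 < M + 1 := Nat.lt_floor_add_one _
  have hsub : Finset.Icc (-(M : ℤ)) M ×ˢ Finset.Icc (-(M : ℤ)) M ⊆ freq L := by
    rintro ⟨n, m⟩ h
    rw [Finset.mem_product, Finset.mem_Icc, Finset.mem_Icc] at h
    have key : ∀ a : ℤ, -(M : ℤ) ≤ a ∧ a ≤ M → (a : ℝ) ^ 2 ≤ L ^ 2 / 100 := by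
      intro a ha
      have h1 : -(M : ℝ) ≤ a := by exact_mod_cast ha.1
      have h2 : (a : ℝ) ≤ M := by exact_mod_cast ha.2
      nlinarith
    rw [mem_freq]
    have h1 := key n h.1
    have h2 := key m h.2
    have h3 : Real.pi ^ 2 ≤ 10 := by nlinarith
    simp only
    have h4 : Real.pi ^ 2 * ((n : ℝ) ^ 2 + (m : ℝ) ^ 2) ≤ 10 * (L ^ 2 / 100 + L ^ 2 / 100) := by
      gcongr
    nlinarith [sq_nonneg L]
  have hcard := Finset.card_le_card hsub
  rw [Finset.card_product, Int.card_Icc] at hcard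
  have e : ((M : ℤ) + 1 - -(M : ℤ)).toNat = 2 * M + 1 := by omega
  rw [e] at hcard
  have : (((2 * M + 1) * (2 * M + 1) : ℕ) : ℝ) ≤ (freq L).card := by exact_mod_cast hcard
  push_cast at this
  have hM0 : (0 : ℝ) ≤ M := Nat.cast_nonneg M
  nlinarith

theorem card_filter_fst_sub_notMem_le {L : ℝ} (hL : 1 ≤ L) {h : ℕ} (hh : 0 < h) :
    (((freq L).filter fun p : ℤ × ℤ => p - ((h : ℤ), 0) ∉ freq L).card : ℝ) ≤ 2 * h * L := by
  classical
  have hpi := Real.pi_gt_three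
  set M : ℕ := ⌊L / 6⌋₊ with hM
  have hM1 : (M : ℝ) ≤ L / 6 := Nat.floor_le (by positivity)
  have hM2 : L / 6 < M + 1 := Nat.lt_floor_add_one _
  have hcard : ((freq L).filter fun p : ℤ × ℤ => p - ((h : ℤ), 0) ∉ freq L).card ≤
      (Finset.Ico (0 : ℤ) h ×ˢ Finset.Icc (-(M : ℤ)) M).card := by
    refine Finset.card_le_card_of_injOn (fun p => (p.1 % h, p.2)) ?_ ?_
    · intro p hp
      have hp1 := (Finset.mem_filter.1 hp).1
      have h1 := abs_snd_le_of_mem_freq (by linarith) hp1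
      have h2 : |(p.2 : ℝ)| < M + 1 := by nlinarith [abs_nonneg (p.2 : ℝ)]
      have h3 := abs_lt.1 h2
      have h4 : p.2 < M + 1 := by exact_mod_cast h3.2
      have h5 : -((M : ℤ) + 1) < p.2 := by exact_mod_cast h3.1
      have h6 := Int.emod_nonneg p.1 (b := h) (by omega)
      have h7 := Int.emod_lt_of_pos p.1 (b := h) (by omega)
      simp only [Finset.coe_product, Finset.coe_Ico, Finset.coe_Icc, Set.mem_prod, Set.mem_Ico,
        Set.mem_Icc]
      omega
    · have key : ∀ n n' b : ℤ, (n, b) ∈ freq L → (n', b) ∈ freq L → (n' - h, b) ∉ freq L →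
          n % h = n' % h → ¬ n < n' := by
        intro n n' b hn hn' hnot hmod hlt
        apply hnot
        have hdvd : (h : ℤ) ∣ n' - n := Int.ModEq.dvd hmod
        have hle : (h : ℤ) ≤ n' - n := Int.le_of_dvd (by omega) hdvd
        rw [mem_freq] at hn hn' ⊢
        simp only at hn hn' ⊢
        have h1 : (n : ℝ) ≤ ((n' - h : ℤ) : ℝ) := by exact_mod_cast (by omega)
        have h2 : ((n' - h : ℤ) : ℝ) ≤ n' := by exact_mod_cast (by omega)
        have h3 : ((n' - h : ℤ) : ℝ) ^ 2 ≤ max ((n : ℝ) ^ 2) ((n' : ℝ) ^ 2) := by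
          rcases le_total 0 ((n' - h : ℤ) : ℝ) with h0 | h0
          · exact le_max_of_le_right (by nlinarith)
          · exact le_max_of_le_left (by nlinarith)
        have hp : (0 : ℝ) ≤ 4 * Real.pi ^ 2 := by positivity
        rcases le_max_iff.1 h3 with h4 | h4
        · exact le_trans (by gcongr) hn
        · exact le_trans (by gcongr) hn'
      rintro ⟨n, b⟩ hp ⟨n', b'⟩ hq hpq
      obtain ⟨hp1, hp2⟩ := Finset.mem_filter.1 hp
      obtain ⟨hq1, hq2⟩ := Finset.mem_filter.1 hq
      simp only [Prod.mk.injEq] at hpq ⊢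
      obtain ⟨hmod, rfl⟩ := hpq
      have h1 := key n n' b hp1 hq1 (by simpa using hq2) hmod
      have h2 := key n' n b hq1 hp1 (by simpa using hp2) hmod.symm
      exact ⟨by omega, rfl⟩
  rw [Finset.card_product, Int.card_Ico, Int.card_Icc] at hcard
  have e : ((M : ℤ) + 1 - -(M : ℤ)).toNat = 2 * M + 1 := by omega
  have e2 : ((h : ℤ) - 0).toNat = h := by omega
  rw [e, e2] at hcard
  have h3 : (((freq L).filter fun p : ℤ × ℤ => p - ((h : ℤ), 0) ∉ freq L).card : ℝ) ≤ h * (2 * M + 1) := by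
    exact_mod_cast hcard
  have hh0 : (0 : ℝ) ≤ h := Nat.cast_nonneg h
  calc _ ≤ (h : ℝ) * (2 * M + 1) := h3
    _ ≤ h * (2 * L) := by gcongr; linarith
    _ = _ := by ring

theorem card_filter_snd_sub_notMem_le {L : ℝ} (hL : 1 ≤ L) {h : ℕ} (hh : 0 < h) :
    (((freq L).filter fun p : ℤ × ℤ => p - (0, (h : ℤ)) ∉ freq L).card : ℝ) ≤ 2 * h * L := by
  refine le_trans ?_ (card_filter_fst_sub_notMem_le hL hh)
  rw [Nat.cast_le]
  refine Finset.card_le_card_of_injOn Prod.swap ?_ Prod.swap_injective.injOn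
  intro p hp
  obtain ⟨hp1, hp2⟩ := Finset.mem_filter.1 hp
  exact Finset.mem_filter.2 ⟨swap_mem_freq.2 hp1, fun h => hp2 (swap_mem_freq.1 h)⟩

end Frequencies

section KernelTail

/-- The Dirichlet kernel with frequency set `S`. -/
def dirichletKernel (S : Finset (ℤ × ℤ)) (x : T2) : ℂ := ∑ p ∈ S, eChar p.1 p.2 x

theorem continuous_dirichletKernel (S : Finset (ℤ × ℤ)) : Continuous (dirichletKernel S) :=
  continuous_finsetSum _ fun p _ => continuous_eChar p.1 p.2

theorem integral_normSq_eChar_sub_one_mul_dirichletKernel (S : Finset (ℤ × ℤ)) (v : ℤ × ℤ) :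
    ∫ x : T2, ‖(eChar v.1 v.2 x - 1) * dirichletKernel S x‖ ^ 2 =
      2 * (S.filter fun p => p - v ∉ S).card := by
  classical
  set S' := S.image (· + v) with hS'
  have hmem : ∀ p, p ∈ S' ↔ p - v ∈ S := by
    intro p
    rw [hS', Finset.mem_image]
    exact ⟨by rintro ⟨q, hq, rfl⟩; simpa using hq, fun h => ⟨p - v, h, by simp⟩⟩
  have hcardS' : S'.card = S.card := Finset.card_image_of_injective _ (add_left_injective v)
  set b : ℤ × ℤ → ℂ := fun p => (if p ∈ S' then 1 else 0) - (if p ∈ S then 1 else 0) with hb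
  have h1 : ∀ x : T2, (eChar v.1 v.2 x - 1) * dirichletKernel S x =
      ∑ p ∈ S' ∪ S, b p * eChar p.1 p.2 x := by
    intro x
    simp only [hb, sub_mul, Finset.sum_sub_distrib, ite_mul, one_mul, zero_mul]
    rw [Finset.sum_ite_mem, Finset.sum_ite_mem,
      Finset.inter_eq_right.2 Finset.subset_union_left,
      Finset.inter_eq_right.2 Finset.subset_union_right, dirichletKernel]
    congr 1
    rw [hS', Finset.sum_image fun p _ q _ h => add_left_injective v h, Finset.mul_sum]
    refine Finset.sum_congr rfl fun p _ => ?_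
    rw [Prod.fst_add, Prod.snd_add, eChar_add_index, mul_comm]
  simp_rw [h1]
  rw [integral_normSq_sum_eChar]
  have h2 : ∀ p, ‖b p‖ ^ 2 = (if p ∈ S' \ S then 1 else 0) + (if p ∈ S \ S' then 1 else 0) := by
    intro p
    by_cases h : p ∈ S' <;> by_cases h' : p ∈ S <;> simp [hb, h, h']
  simp_rw [h2]
  have e1 : (S' ∪ S) ∩ (S' \ S) = S' \ S :=
    Finset.inter_eq_right.2 (Finset.sdiff_subset.trans Finset.subset_union_left)
  have e2 : (S' ∪ S) ∩ (S \ S') = S \ S' :=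
    Finset.inter_eq_right.2 (Finset.sdiff_subset.trans Finset.subset_union_right)
  have e3 : S.filter (fun p => p - v ∉ S) = S \ S' := by
    ext p; rw [Finset.mem_filter, Finset.mem_sdiff, hmem]
  rw [Finset.sum_add_distrib, Finset.sum_ite_mem, Finset.sum_ite_mem, e1, e2, e3,
    Finset.sum_const, Finset.sum_const, Finset.card_sdiff_comm hcardS']
  simp only [nsmul_eq_mul, mul_one]
  ring

/-- A continuous weight which is small near the origin and at least `1` outside the ball of
radius `1/H`. -/
def tailWeight (H : ℕ) (x : T2) : ℝ :=
  (H : ℝ)⁻¹ * ∑ h ∈ Finset.range H, (‖eChar ((h + 1 : ℕ) : ℤ) 0 x - 1‖ ^ 2 +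
    ‖eChar 0 ((h + 1 : ℕ) : ℤ) x - 1‖ ^ 2)

theorem continuous_tailWeight (H : ℕ) : Continuous (tailWeight H) := by
  refine continuous_const.mul (continuous_finsetSum _ fun h _ => ?_)
  exact (((continuous_eChar _ _).sub continuous_const).norm.pow 2).add
    (((continuous_eChar _ _).sub continuous_const).norm.pow 2)

theorem tailWeight_nonneg (H : ℕ) (x : T2) : 0 ≤ tailWeight H x := by
  unfold tailWeight; positivity

theorem one_le_tailWeight {H : ℕ} {x : T2} (hH : 0 < H) (hx : 1 ≤ H * ‖x‖) :
    1 ≤ tailWeight H x := by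
  have hH' : (0 : ℝ) < H := by exact_mod_cast hH
  rw [tailWeight, inv_mul_eq_div, le_div_iff₀ hH', one_mul, Finset.sum_add_distrib]
  simp only [eChar, fourier_zero, mul_one, one_mul]
  rw [Prod.norm_def] at hx
  rcases max_choice ‖x.1‖ ‖x.2‖ with h | h
  · rw [h] at hx
    exact (le_sum_normSq_fourier_sub_one hx).trans (le_add_of_nonneg_right (by positivity))
  · rw [h] at hx
    exact (le_sum_normSq_fourier_sub_one hx).trans (le_add_of_nonneg_left (by positivity))

theorem integral_tailWeight_mul_normSq_dirichletKernel_le {L : ℝ} (hL : 1 ≤ L) {H : ℕ}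
    (hH : 0 < H) :
    ∫ x : T2, tailWeight H x * ‖dirichletKernel (freq L) x‖ ^ 2 ≤ 8 * H * L := by
  have hH' : (0 : ℝ) < H := by exact_mod_cast hH
  set D := dirichletKernel (freq L)
  have hD : Continuous D := continuous_dirichletKernel _
  have hint : ∀ n m : ℤ, Integrable fun x : T2 => ‖(eChar n m x - 1) * D x‖ ^ 2 := fun n m =>
    ((((continuous_eChar n m).sub continuous_const).mul hD).norm.pow 2).integrable_T2
  have h1 : ∀ x : T2, tailWeight H x * ‖D x‖ ^ 2 = (H : ℝ)⁻¹ * ∑ h ∈ Finset.range H,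
      (‖(eChar ((h + 1 : ℕ) : ℤ) 0 x - 1) * D x‖ ^ 2 +
        ‖(eChar 0 ((h + 1 : ℕ) : ℤ) x - 1) * D x‖ ^ 2) := by
    intro x
    simp only [tailWeight, norm_mul, mul_pow]
    rw [mul_assoc, Finset.sum_mul]
    simp only [add_mul]
  simp_rw [h1]
  have hint2 : ∀ h ∈ Finset.range H, Integrable fun x : T2 =>
      ‖(eChar ((h + 1 : ℕ) : ℤ) 0 x - 1) * D x‖ ^ 2 +
        ‖(eChar 0 ((h + 1 : ℕ) : ℤ) x - 1) * D x‖ ^ 2 := fun h _ => (hint _ _).add (hint _ _)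
  rw [integral_const_mul, integral_finsetSum _ hint2, inv_mul_le_iff₀ hH']
  calc _ ≤ ∑ h ∈ Finset.range H, 8 * H * L := by
        refine Finset.sum_le_sum fun h hh => ?_
        rw [integral_add (hint _ _) (hint _ _)]
        have e1 := integral_normSq_eChar_sub_one_mul_dirichletKernel (freq L)
          (((h + 1 : ℕ) : ℤ), 0)
        have e2 := integral_normSq_eChar_sub_one_mul_dirichletKernel (freq L)
          (0, ((h + 1 : ℕ) : ℤ))
        have b1 := card_filter_fst_sub_notMem_le hL h.succ_pos
        have b2 := card_filter_snd_sub_notMem_le hL h.succ_pos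
        have b3 : ((h + 1 : ℕ) : ℝ) ≤ H := by exact_mod_cast Finset.mem_range.1 hh
        have b4 : ((h + 1 : ℕ) : ℝ) * L ≤ H * L := by gcongr
        simp only [Nat.succ_eq_add_one] at b1 b2
        rw [e1, e2]
        linarith
    _ = _ := by rw [Finset.sum_const, Finset.card_range, nsmul_eq_mul]

end KernelTail

section Concentration

/-- The vector representing evaluation at `x` on trigonometric polynomials with frequencies in
`S`. -/
def evalVec (S : Finset (ℤ × ℤ)) (x : T2) : EuclideanSpace ℂ S :=
  WithLp.toLp 2 fun p => conj (eChar p.1.1 p.1.2 x)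

variable {S : Finset (ℤ × ℤ)}

theorem inner_evalVec (x : T2) (a : ℤ × ℤ → ℂ) :
    inner ℂ (evalVec S x) (WithLp.toLp 2 fun p : S => a p) = ∑ p ∈ S, a p * eChar p.1 p.2 x := by
  rw [PiLp.inner_apply, ← Finset.sum_coe_sort S fun p => a p * eChar p.1 p.2 x]
  simp [evalVec, RCLike.inner_apply]

theorem inner_evalVec_evalVec (x y : T2) :
    inner ℂ (evalVec S y) (evalVec S x) = conj (dirichletKernel S (x - y)) := by
  have h := inner_evalVec (S := S) y fun p => conj (eChar p.1 p.2 x)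
  refine h.trans ?_
  rw [dirichletKernel, map_sum]
  refine Finset.sum_congr rfl fun p _ => ?_
  rw [eChar_sub, map_mul, Complex.conj_conj]

theorem normSq_evalVec (x : T2) : ‖evalVec S x‖ ^ 2 = S.card := by
  rw [EuclideanSpace.norm_sq_eq]
  simp [evalVec, norm_eChar]

theorem integral_normSq_inner_evalVec (a : EuclideanSpace ℂ S) :
    ∫ x : T2, ‖inner ℂ (evalVec S x) a‖ ^ 2 = ‖a‖ ^ 2 := by
  classical
  set a' : ℤ × ℤ → ℂ := fun p => if h : p ∈ S then a ⟨p, h⟩ else 0 with ha'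
  have h1 : a = WithLp.toLp 2 fun p : S => a' p := by
    ext p; simp [ha']
  have h2 : ‖a‖ ^ 2 = ∑ p ∈ S, ‖a' p‖ ^ 2 := by
    rw [EuclideanSpace.norm_sq_eq, ← Finset.sum_coe_sort S fun p => ‖a' p‖ ^ 2]
    simp [ha']
  rw [h2, ← integral_normSq_sum_eChar]
  congr 1
  ext x
  rw [← inner_evalVec, ← h1]

theorem continuous_inner_evalVec (a : EuclideanSpace ℂ S) :
    Continuous fun x => inner ℂ (evalVec S x) a := by
  simp only [PiLp.inner_apply, evalVec, RCLike.inner_apply]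
  refine continuous_finsetSum _ fun p _ => continuous_const.mul ?_
  exact Complex.continuous_conj.comp (Complex.continuous_conj.comp (continuous_eChar _ _))

/-- Trigonometric polynomials with frequencies in `S` interpolate arbitrary data at the points
`z j`, `j ∈ J`, with squared `L²` norm at most `A` times the squared `ℓ²` norm of the data. -/
def InterpolatesWith (S : Finset (ℤ × ℤ)) (J : Finset ℕ) (z : ℕ → T2) (A : ℝ) : Prop :=
  ∀ c : ℕ → ℂ, ∃ a : ℤ × ℤ → ℂ, (∀ j ∈ J, ∑ p ∈ S, a p * eChar p.1 p.2 (z j) = c j) ∧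
    ∑ p ∈ S, ‖a p‖ ^ 2 ≤ A * ∑ j ∈ J, ‖c j‖ ^ 2

/-- If trigonometric polynomials with frequencies in `S` interpolate at the points `z j`, `j ∈ J`,
with constant `A`, then the number of points is controlled by the measure of a set `B` and by the
mass outside `B` of the reproducing kernels at these points. -/
theorem InterpolatesWith.card_le {J : Finset ℕ} {z : ℕ → T2} {A : ℝ}
    (hint : InterpolatesWith S J z A)
    {B : Set T2} (hB : MeasurableSet B) :
    (J.card : ℝ) ≤ S.card * volume.real B +
      A * ∑ j ∈ J, ∫ x in Bᶜ, ‖dirichletKernel S (x - z j)‖ ^ 2 := by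
  classical
  have hint' : ∀ c : ℕ → ℂ, ∃ a : EuclideanSpace ℂ S,
      (∀ j ∈ J, inner ℂ (evalVec S (z j)) a = c j) ∧ ‖a‖ ^ 2 ≤ A * ∑ j ∈ J, ‖c j‖ ^ 2 := by
    intro c
    obtain ⟨a, ha1, ha2⟩ := hint c
    refine ⟨WithLp.toLp 2 fun p : S => a p, fun j hj => (inner_evalVec _ _).trans (ha1 j hj), ?_⟩
    rw [EuclideanSpace.norm_sq_eq]
    exact (Finset.sum_coe_sort S fun p => ‖a p‖ ^ 2).trans_le ha2
  have hli : LinearIndependent ℂ fun j : J => evalVec S (z j) := by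
    rw [Fintype.linearIndependent_iff]
    intro g hg i
    obtain ⟨a, ha, -⟩ := hint' fun j => if j = i then 1 else 0
    have h0 : inner ℂ (∑ j, g j • evalVec S (z j)) a = 0 := by rw [hg, inner_zero_left]
    rw [sum_inner] at h0
    simp only [inner_smul_left] at h0
    rw [Finset.sum_eq_single i] at h0
    · rw [ha i i.2] at h0
      simpa using h0
    · intro j _ hji
      rw [ha j j.2, if_neg (fun h => hji (Subtype.ext h)), mul_zero]
    · simp
  set W := Submodule.span ℂ (Set.range fun j : J => evalVec S (z j)) with hW
  have hdim : Module.finrank ℂ W = J.card := by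
    rw [hW, finrank_span_eq_card hli, Fintype.card_coe]
  set b := stdOrthonormalBasis ℂ W
  have hu : Orthonormal ℂ fun i => (b i : EuclideanSpace ℂ S) :=
    b.orthonormal.comp_linearIsometry W.subtypeₗᵢ
  set φ : T2 → ℝ := fun x => ∑ i, ‖inner ℂ (b i : EuclideanSpace ℂ S) (evalVec S x)‖ ^ 2 with hφ
  have hφc : ∀ i, Continuous fun x =>
      ‖inner ℂ (b i : EuclideanSpace ℂ S) (evalVec S x)‖ ^ 2 := fun i => by
    simp only [norm_inner_symm (b i : EuclideanSpace ℂ S)]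
    exact (continuous_inner_evalVec _).norm.pow 2
  have hφi : Integrable φ := (continuous_finsetSum _ fun i _ => hφc i).integrable_T2
  have hφint : ∫ x, φ x = J.card := by
    rw [hφ, integral_finsetSum _ fun i _ => (hφc i).integrable_T2]
    simp only [norm_inner_symm (b _ : EuclideanSpace ℂ S), integral_normSq_inner_evalVec]
    simp [hu.1, hdim]
  have hφ1 : ∀ x, φ x ≤ S.card := fun x => by
    rw [← normSq_evalVec x]; exact hu.sum_inner_products_le _
  have hφ2 : ∀ x, φ x ≤ A * ∑ j ∈ J, ‖dirichletKernel S (x - z j)‖ ^ 2 := by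
    intro x
    obtain ⟨a, ha1, ha2⟩ := hint' fun j => inner ℂ (evalVec S (z j)) (evalVec S x)
    simp only [inner_evalVec_evalVec, RCLike.norm_conj] at ha2
    refine le_trans ?_ ha2
    have heq : ∀ w ∈ W, inner ℂ w (evalVec S x) = inner ℂ w a := by
      intro w hw
      induction hw using Submodule.span_induction with
      | mem w hw => obtain ⟨j, rfl⟩ := hw; exact (ha1 j j.2).symm
      | zero => simp
      | add u v _ _ hu hv => rw [inner_add_left, inner_add_left, hu, hv]
      | smul c u _ hu => rw [inner_smul_left, inner_smul_left, hu]
    simp only [hφ]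
    rw [Finset.sum_congr rfl fun i _ => by rw [heq _ (b i).2]]
    exact hu.sum_inner_products_le _
  have hDi : ∀ j, Integrable fun x : T2 => ‖dirichletKernel S (x - z j)‖ ^ 2 := fun j =>
    (((continuous_dirichletKernel S).comp
      (continuous_id.sub continuous_const)).norm.pow 2).integrable_T2
  rw [← hφint, ← integral_add_compl hB hφi]
  refine add_le_add ?_ ?_
  · refine (setIntegral_mono hφi.integrableOn (integrable_const (S.card : ℝ)).integrableOn
      hφ1).trans_eq ?_
    rw [setIntegral_const, smul_eq_mul, mul_comm]
  · refine (setIntegral_mono hφi.integrableOn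
      ((integrable_finsetSum _ fun j _ => hDi j).const_mul A).integrableOn hφ2).trans_eq ?_
    rw [integral_const_mul, integral_finsetSum _ fun j _ => (hDi j).integrableOn]

end Concentration

section InterpolationConstants

variable {S : Finset (ℤ × ℤ)} {J : Finset ℕ} {z : ℕ → T2}

theorem InterpolatesWith.mono {A A' : ℝ} (h : InterpolatesWith S J z A) (hA : A ≤ A') :
    InterpolatesWith S J z A' := fun c => by
  obtain ⟨a, ha, ha2⟩ := h c
  exact ⟨a, ha, ha2.trans (by gcongr)⟩

theorem InterpolatesWith.subset {A : ℝ} (h : InterpolatesWith S J z A) {I : Finset ℕ}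
    (hI : I ⊆ J) : InterpolatesWith S I z A := fun c => by
  classical
  obtain ⟨a, ha, ha2⟩ := h fun j => if j ∈ I then c j else 0
  refine ⟨a, fun j hj => by rw [ha j (hI hj), if_pos hj], ha2.trans_eq ?_⟩
  have : ∀ j, ‖if j ∈ I then c j else 0‖ ^ 2 = if j ∈ I then ‖c j‖ ^ 2 else 0 := fun j => by
    split_ifs <;> simp
  simp_rw [this]
  rw [Finset.sum_ite_mem, Finset.inter_eq_right.2 hI]

/-- By homogeneity, interpolation constants may be tested on data of bounded norm. -/
theorem interpolatesWith_of_bounded {A k : ℝ} (hk : 0 < k)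
    (h : ∀ c : ℕ → ℂ, ∑ j ∈ J, ‖c j‖ ^ 2 ≤ k → ∃ a : ℤ × ℤ → ℂ,
      (∀ j ∈ J, ∑ p ∈ S, a p * eChar p.1 p.2 (z j) = c j) ∧ ∑ p ∈ S, ‖a p‖ ^ 2 ≤ A * k) :
    InterpolatesWith S J z A := by
  intro c
  rcases (Finset.sum_nonneg fun j (_ : j ∈ J) => sq_nonneg ‖c j‖).eq_or_lt with h0 | h0
  · have hc := (Finset.sum_eq_zero_iff_of_nonneg fun j _ => sq_nonneg ‖c j‖).1 h0.symm
    refine ⟨0, fun j hj => ?_, by simp [← h0]⟩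
    have h1 : c j = 0 := by simpa using hc j hj
    simp [h1]
  · set s := ∑ j ∈ J, ‖c j‖ ^ 2 with hs
    set t : ℝ := Real.sqrt (k / s) with ht
    have ht2 : t ^ 2 = k / s := Real.sq_sqrt (by positivity)
    have ht0 : 0 < t := Real.sqrt_pos.2 (by positivity)
    obtain ⟨a, ha, ha2⟩ := h (fun j => t * c j) (by
      simp only [norm_mul, mul_pow, Complex.norm_real, Real.norm_eq_abs, sq_abs]
      rw [← Finset.mul_sum, ← hs, ht2, div_mul_cancel₀ _ h0.ne'])
    have htc : (t : ℂ) ≠ 0 := by exact_mod_cast ht0.ne'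
    refine ⟨fun p => (t : ℂ)⁻¹ * a p, fun j hj => ?_, ?_⟩
    · simp only [mul_assoc]
      rw [← Finset.mul_sum, ha j hj, inv_mul_cancel_left₀ htc]
    · simp only [norm_mul, mul_pow, norm_inv, Complex.norm_real, Real.norm_eq_abs, inv_pow, sq_abs]
      rw [← Finset.mul_sum, ht2, inv_mul_le_iff₀ (by positivity)]
      calc _ ≤ A * k := ha2
        _ = _ := by field_simp

/-- Interpolation with a finite constant is automatic for finitely many points. -/
theorem exists_interpolatesWith
    (h : ∀ c : ℕ → ℂ, ∃ a : ℤ × ℤ → ℂ, ∀ j ∈ J, ∑ p ∈ S, a p * eChar p.1 p.2 (z j) = c j) :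
    ∃ A : ℝ, InterpolatesWith S J z A := by
  classical
  choose a ha using fun i : ℕ => h fun j => if j = i then 1 else 0
  refine ⟨∑ p ∈ S, ∑ i ∈ J, ‖a i p‖ ^ 2, fun c => ⟨fun p => ∑ i ∈ J, c i * a i p, ?_, ?_⟩⟩
  · intro j hj
    simp only [Finset.sum_mul]
    rw [Finset.sum_comm]
    simp only [mul_assoc]
    simp_rw [← Finset.mul_sum]
    rw [Finset.sum_congr rfl fun i _ => by rw [ha i j hj]]
    simp [hj]
  · rw [Finset.sum_mul]
    refine Finset.sum_le_sum fun p _ => ?_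
    calc ‖∑ i ∈ J, c i * a i p‖ ^ 2 ≤ (∑ i ∈ J, ‖c i‖ * ‖a i p‖) ^ 2 := by
          gcongr
          exact (norm_sum_le _ _).trans_eq (Finset.sum_congr rfl fun i _ => norm_mul _ _)
      _ ≤ (∑ i ∈ J, ‖c i‖ ^ 2) * ∑ i ∈ J, ‖a i p‖ ^ 2 := Finset.sum_mul_sq_le_sq_mul_sq _ _ _
      _ = _ := mul_comm _ _

theorem card_freq_pos {L : ℝ} (hL : 1 ≤ L) : (0 : ℝ) < (freq L).card :=
  lt_of_lt_of_le (by positivity) (le_card_freq (by linarith))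

/-- An `L²`-interpolating family is interpolating with uniform constants. -/
theorem exists_uniform_interpolatesWith {m : ℝ → ℕ} {z : ℝ → ℕ → T2}
    (hint : ∀ c : ℝ → ℕ → ℂ,
      (∃ B : ℝ, ∀ L : ℝ, 1 ≤ L →
        (kL L : ℝ)⁻¹ * ∑ j ∈ Finset.range (m L), ‖c L j‖ ^ 2 ≤ B) →
      ∃ f : ℝ → T2 → ℂ,
        (∀ L : ℝ, 1 ≤ L → f L ∈ EL L) ∧
        (∃ B : ℝ, ∀ L : ℝ, 1 ≤ L → ∫ p : T2, ‖f L p‖ ^ 2 ≤ B) ∧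
        (∀ L : ℝ, 1 ≤ L → ∀ j < m L, f L (z L j) = c L j)) :
    ∃ C : ℝ, 0 < C ∧ ∀ L : ℝ, 1 ≤ L →
      InterpolatesWith (freq L) (Finset.range (m L)) (z L) (C / (freq L).card) := by
  classical
  set P : ℝ → ℕ → Prop := fun L n =>
    InterpolatesWith (freq L) (Finset.range (m L)) (z L) ((n : ℝ) / (freq L).card) with hP
  have hfin : ∀ L : ℝ, 1 ≤ L → ∃ n, P L n := by
    intro L hL
    obtain ⟨A, hA⟩ := exists_interpolatesWith (S := freq L) (J := Finset.range (m L)) (z := z L) (by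
      intro c
      obtain ⟨f, hf, -, hfz⟩ := hint (fun L' => if L' = L then c else 0)
        ⟨max 0 ((kL L : ℝ)⁻¹ * ∑ j ∈ Finset.range (m L), ‖c j‖ ^ 2), fun L' _ => by
          by_cases h : L' = L
          · subst h; simp
          · simp [h]⟩
      obtain ⟨a, ha⟩ := mem_EL_iff.1 (hf L hL)
      refine ⟨a, fun j hj => ?_⟩
      have := hfz L hL j (Finset.mem_range.1 hj)
      rwa [ha, if_pos rfl] at this)
    obtain ⟨n, hn⟩ := exists_nat_ge (A * (freq L).card)
    exact ⟨n, hA.mono ((le_div_iff₀ (card_freq_pos hL)).2 hn)⟩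
  have hbad : ∀ (L : ℝ) (n : ℕ), 1 ≤ L → ¬ P L n → ∃ c : ℕ → ℂ,
      ∑ j ∈ Finset.range (m L), ‖c j‖ ^ 2 ≤ (freq L).card ∧ ∀ a : ℤ × ℤ → ℂ,
      (∀ j ∈ Finset.range (m L), ∑ p ∈ freq L, a p * eChar p.1 p.2 (z L j) = c j) →
        (n : ℝ) < ∑ p ∈ freq L, ‖a p‖ ^ 2 := by
    intro L n hL hn
    by_contra! hcon
    refine hn (interpolatesWith_of_bounded (card_freq_pos hL) fun c hc => ?_)
    obtain ⟨a, ha, ha2⟩ := hcon c hc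
    exact ⟨a, ha, by rwa [div_mul_cancel₀ _ (card_freq_pos hL).ne']⟩
  have hsel : ∀ L : ℝ, ∃ c : ℕ → ℂ, 1 ≤ L →
      ∑ j ∈ Finset.range (m L), ‖c j‖ ^ 2 ≤ (freq L).card ∧ ∀ B : ℝ, ∀ a : ℤ × ℤ → ℂ,
      (∀ j ∈ Finset.range (m L), ∑ p ∈ freq L, a p * eChar p.1 p.2 (z L j) = c j) →
        ∑ p ∈ freq L, ‖a p‖ ^ 2 ≤ B → ∃ n : ℕ, (n : ℝ) ≤ |B| + 1 ∧ P L n := by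
    intro L
    by_cases hL : 1 ≤ L
    · have hspec := Nat.find_spec (hfin L hL)
      have hmin := fun n => Nat.find_min (hfin L hL) (m := n)
      rcases h : Nat.find (hfin L hL) with _ | n
      · rw [h] at hspec
        refine ⟨0, fun _ => ⟨by simp, fun B a _ _ => ⟨0, ?_, hspec⟩⟩⟩
        rw [Nat.cast_zero]; positivity
      · rw [h] at hspec
        obtain ⟨c, hc, hca⟩ := hbad L n hL (hmin n (by omega))
        refine ⟨c, fun _ => ⟨hc, fun B a ha haB => ⟨n + 1, ?_, hspec⟩⟩⟩
        have := hca a ha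
        push_cast
        linarith [le_abs_self B]
    · exact ⟨0, fun h => absurd h hL⟩
  choose c hc using hsel
  obtain ⟨f, hf, ⟨B, hB⟩, hfz⟩ := hint c ⟨1, fun L hL => by
    rw [kL_eq_card, inv_mul_le_iff₀ (card_freq_pos hL), mul_one]
    exact (hc L hL).1⟩
  refine ⟨|B| + 1, by positivity, fun L hL => ?_⟩
  obtain ⟨a, ha⟩ := mem_EL_iff.1 (hf L hL)
  have hBL := hB L hL
  rw [ha, integral_normSq_sum_eChar] at hBL
  obtain ⟨n, hn, hPn⟩ := (hc L hL).2 B a (fun j hj => by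
    have := hfz L hL j (Finset.mem_range.1 hj)
    rwa [ha] at this) hBL
  exact hPn.mono (by gcongr)

theorem InterpolatesWith.le_dist {L C : ℝ} (hL : 1 ≤ L) (hC : 0 < C)
    (h : InterpolatesWith (freq L) J z (C / (freq L).card)) {i j : ℕ} (hi : i ∈ J) (hj : j ∈ J)
    (hij : i ≠ j) : (2 * Real.sqrt C)⁻¹ / L ≤ dist (z i) (z j) := by
  classical
  have hk := card_freq_pos hL
  obtain ⟨a, ha, ha2⟩ := h fun l => if l = i then 1 else 0
  have hs : ∑ l ∈ J, ‖(if l = i then 1 else 0 : ℂ)‖ ^ 2 = 1 := by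
    rw [Finset.sum_eq_single i (fun l _ hl => by simp [hl]) (fun h => absurd hi h)]
    simp
  rw [hs, mul_one] at ha2
  have h1 : (1 : ℂ) = ∑ p ∈ freq L, a p * (eChar p.1 p.2 (z i) - eChar p.1 p.2 (z j)) := by
    simp only [mul_sub, Finset.sum_sub_distrib]
    rw [ha i hi, ha j hj, if_pos rfl, if_neg hij.symm, sub_zero]
  set d := dist (z i) (z j) with hd
  have hd0 : 0 ≤ d := dist_nonneg
  have hp : ∀ p ∈ freq L, ‖eChar p.1 p.2 (z i) - eChar p.1 p.2 (z j)‖ ^ 2 ≤ (2 * L * d) ^ 2 := by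
    intro p hp
    have e1 := abs_fst_le_of_mem_freq (by linarith) hp
    have e2 := abs_snd_le_of_mem_freq (by linarith) hp
    have e3 : 2 * Real.pi * (|(p.1 : ℝ)| + |(p.2 : ℝ)|) ≤ 2 * L := by linarith
    gcongr
    exact (norm_eChar_sub_eChar_le _ _ _ _).trans (by gcongr)
  have h2 : (1 : ℝ) ≤ C * (2 * L * d) ^ 2 := by
    calc (1 : ℝ) = ‖(1 : ℂ)‖ ^ 2 := by simp
      _ ≤ (∑ p ∈ freq L, ‖a p‖ * ‖eChar p.1 p.2 (z i) - eChar p.1 p.2 (z j)‖) ^ 2 := by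
          rw [h1]
          gcongr
          exact (norm_sum_le _ _).trans_eq (Finset.sum_congr rfl fun i _ => norm_mul _ _)
      _ ≤ (∑ p ∈ freq L, ‖a p‖ ^ 2) *
          ∑ p ∈ freq L, ‖eChar p.1 p.2 (z i) - eChar p.1 p.2 (z j)‖ ^ 2 :=
          Finset.sum_mul_sq_le_sq_mul_sq _ _ _
      _ ≤ C / (freq L).card * ∑ p ∈ freq L, (2 * L * d) ^ 2 := by
          exact mul_le_mul ha2 (Finset.sum_le_sum hp) (by positivity) (by positivity)
      _ = C * (2 * L * d) ^ 2 := by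
          rw [Finset.sum_const, nsmul_eq_mul]
          field_simp
  have h3 : 1 ≤ Real.sqrt C * (2 * L * d) := by
    have h4 : (1 : ℝ) ^ 2 ≤ (Real.sqrt C * (2 * L * d)) ^ 2 := by
      rw [mul_pow, Real.sq_sqrt hC.le]; linarith
    exact le_of_sq_le_sq h4 (by positivity)
  have hsC := Real.sqrt_pos.2 hC
  rw [div_le_iff₀ (by linarith), inv_le_iff_one_le_mul₀ (by positivity)]
  linarith

end InterpolationConstants

section Density

theorem volume_real_closedBall_T2 (ξ : T2) {ρ : ℝ} (hρ : 0 ≤ ρ) :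
    volume.real (Metric.closedBall ξ ρ) = min 1 (2 * ρ) ^ 2 := by
  have h0 : 0 ≤ min 1 (2 * ρ) := by positivity
  rw [← Prod.mk.eta (p := ξ), ← closedBall_prod_same, Measure.volume_eq_prod, Measure.real,
    Measure.prod_prod, AddCircle.volume_closedBall, AddCircle.volume_closedBall,
    ENNReal.toReal_mul, ENNReal.toReal_ofReal h0, sq]

theorem le_volume_real_ball_T2 (ξ : T2) {ρ : ℝ} (hρ : 0 < ρ) (hρ2 : ρ ≤ 1 / 2) :
    (2 * ρ) ^ 2 ≤ volume.real (Metric.ball ξ ρ) := by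
  have ht : Tendsto (fun s : ℝ => (2 * s) ^ 2) (nhdsWithin ρ (Set.Iio ρ)) (nhds ((2 * ρ) ^ 2)) :=
    (Continuous.tendsto (by fun_prop) ρ).mono_left nhdsWithin_le_nhds
  refine le_of_tendsto ht ?_
  filter_upwards [Ioo_mem_nhdsLT hρ] with s hs
  have h1 := volume_real_closedBall_T2 ξ hs.1.le
  rw [min_eq_right (by linarith [hs.2])] at h1
  rw [← h1]
  exact measureReal_mono (Metric.closedBall_subset_ball hs.2)

instance isAddRightInvariant_volume_T2 : (volume : Measure T2).IsAddRightInvariant :=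
  inferInstanceAs ((volume : Measure (AddCircle (1 : ℝ))).prod
    (volume : Measure (AddCircle (1 : ℝ)))).IsAddRightInvariant

theorem setIntegral_normSq_dirichletKernel_le {L r ρ : ℝ} (hL : 1 ≤ L) (hr : 0 < r) (hrL : r ≤ L)
    {ξ w : T2} (hw : dist w ξ ≤ ρ) :
    ∫ x in (Metric.closedBall ξ (ρ + r / L))ᶜ, ‖dirichletKernel (freq L) (x - w)‖ ^ 2 ≤
      16 * L ^ 2 / r := by
  set D := dirichletKernel (freq L)
  have hL0 : 0 < L := by linarith
  set H := ⌈L / r⌉₊ with hH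
  have hH0 : 0 < H := Nat.ceil_pos.2 (by positivity)
  have hH1 : L / r ≤ H := Nat.le_ceil _
  have hH2 : (H : ℝ) ≤ 2 * (L / r) := by
    have := Nat.ceil_lt_add_one (show 0 ≤ L / r by positivity)
    have h1 : 1 ≤ L / r := (one_le_div hr).2 hrL
    linarith
  have hD : Continuous D := continuous_dirichletKernel _
  have hcs : Continuous fun x : T2 => x - w := continuous_id.sub continuous_const
  have hcont : Continuous fun x => tailWeight H x * ‖D x‖ ^ 2 :=
    (continuous_tailWeight H).mul (hD.norm.pow 2)
  have hi : Integrable fun x => tailWeight H (x - w) * ‖D (x - w)‖ ^ 2 :=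
    (hcont.comp hcs).integrable_T2
  have hi2 : Integrable fun x => ‖D (x - w)‖ ^ 2 := ((hD.comp hcs).norm.pow 2).integrable_T2
  calc _ ≤ ∫ x in (Metric.closedBall ξ (ρ + r / L))ᶜ, tailWeight H (x - w) * ‖D (x - w)‖ ^ 2 := by
        refine setIntegral_mono_on hi2.integrableOn hi.integrableOn
          Metric.isClosed_closedBall.measurableSet.compl fun x hx => ?_
        refine le_mul_of_one_le_left (sq_nonneg _) (one_le_tailWeight hH0 ?_)
        rw [Set.mem_compl_iff, Metric.mem_closedBall, not_le] at hx
        have h1 := dist_triangle x w ξ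
        have h2 : r / L ≤ ‖x - w‖ := by rw [← dist_eq_norm]; linarith
        calc (1 : ℝ) = L / r * (r / L) := by field_simp
          _ ≤ H * ‖x - w‖ := by gcongr
    _ ≤ ∫ x, tailWeight H (x - w) * ‖D (x - w)‖ ^ 2 :=
        setIntegral_le_integral hi (Eventually.of_forall fun x =>
          mul_nonneg (tailWeight_nonneg _ _) (sq_nonneg _))
    _ = ∫ x, tailWeight H x * ‖D x‖ ^ 2 :=
        integral_sub_right_eq_self (fun x => tailWeight H x * ‖D x‖ ^ 2) w
    _ ≤ 8 * H * L := integral_tailWeight_mul_normSq_dirichletKernel_le hL hH0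
    _ ≤ 8 * (2 * (L / r)) * L := by gcongr
    _ = _ := by ring

theorem InterpolatesWith.card_mul_le {J : Finset ℕ} {z : ℕ → T2} {L C r R : ℝ} (hL : 1 ≤ L)
    (hC : 0 < C) (hr : 0 < r) (hrL : r ≤ L) (hR : 0 < R)
    (h : InterpolatesWith (freq L) J z (C / (freq L).card)) {ξ : T2}
    (hJ : ∀ j ∈ J, dist (z j) ξ ≤ R / L) :
    (J.card : ℝ) * (1 - 1600 * C / r) ≤ (freq L).card * (2 * ((R + r) / L)) ^ 2 := by
  have hL0 : 0 < L := by linarith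
  have hk := card_freq_pos hL
  have hk2 := le_card_freq hL0.le
  have h1 := h.card_le (B := Metric.closedBall ξ (R / L + r / L))
    Metric.isClosed_closedBall.measurableSet
  have h2 : volume.real (Metric.closedBall ξ (R / L + r / L)) ≤ (2 * ((R + r) / L)) ^ 2 := by
    rw [volume_real_closedBall_T2 ξ (by positivity), ← add_div]
    gcongr
    exact min_le_right _ _
  have h3 := Finset.sum_le_sum fun j hj =>
    setIntegral_normSq_dirichletKernel_le hL hr hrL (hJ j hj)
  rw [Finset.sum_const, nsmul_eq_mul] at h3
  have h4 : C / (freq L).card * (J.card * (16 * L ^ 2 / r)) ≤ J.card * (1600 * C / r) := by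
    have e : C / (freq L).card * (J.card * (16 * L ^ 2 / r)) =
        J.card * (1600 * C / r) * ((L ^ 2 / 100) / (freq L).card) := by ring
    rw [e]
    exact mul_le_of_le_one_right (by positivity) ((div_le_one hk).2 hk2)
  have h5 := h1.trans (add_le_add (mul_le_mul_of_nonneg_left h2 hk.le)
    ((mul_le_mul_of_nonneg_left h3 (by positivity)).trans h4))
  linarith

/-- The quantitative density bound at a fixed scale. -/
theorem InterpolatesWith.ncard_div_le {m : ℕ} {z : ℕ → T2} {L C R s : ℝ} (hL : 1 ≤ L)
    (hC : 0 < C) (hR : 0 < R) (hs : 0 < s) (hs1 : 1600 * C / (s * R) < 1) (hsL : s * R ≤ L)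
    (hRL : 2 * R ≤ L) (h : InterpolatesWith (freq L) (Finset.range m) z (C / (freq L).card))
    (ξ : T2) :
    (({p | ∃ j < m, z j = p} ∩ Metric.ball ξ (R / L)).ncard : ℝ) /
      ((kL L : ℝ) * (volume (Metric.ball ξ (R / L))).toReal) ≤
        (1 + s) ^ 2 / (1 - 1600 * C / (s * R)) := by
  classical
  have hL0 : 0 < L := by linarith
  have hk := card_freq_pos hL
  set J := (Finset.range m).filter fun j => z j ∈ Metric.ball ξ (R / L) with hJ
  have hcard : ({p | ∃ j < m, z j = p} ∩ Metric.ball ξ (R / L)).ncard ≤ J.card := by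
    have hsub : {p | ∃ j < m, z j = p} ∩ Metric.ball ξ (R / L) ⊆ (J.image z : Set T2) := by
      rintro p ⟨⟨j, hj, rfl⟩, hp⟩
      rw [Finset.mem_coe]
      exact Finset.mem_image_of_mem z (Finset.mem_filter.2 ⟨Finset.mem_range.2 hj, hp⟩)
    refine (Set.ncard_le_ncard hsub (Finset.finite_toSet _)).trans ?_
    rw [Set.ncard_coe_finset]
    exact Finset.card_image_le
  have h1 := (h.subset (Finset.filter_subset _ _ : J ⊆ _)).card_mul_le hL hC
    (mul_pos hs hR) hsL hR (ξ := ξ) fun j hj => (Finset.mem_filter.1 hj).2.le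
  have hV := le_volume_real_ball_T2 ξ (ρ := R / L) (by positivity) (by
    rw [div_le_iff₀ hL0]; linarith)
  have hV0 : 0 < (2 * (R / L)) ^ 2 := by positivity
  have hδ : 0 < 1 - 1600 * C / (s * R) := by linarith
  rw [kL_eq_card]
  change _ / (((freq L).card : ℝ) * volume.real (Metric.ball ξ (R / L))) ≤ _
  calc _ ≤ (J.card : ℝ) / ((freq L).card * (2 * (R / L)) ^ 2) := by
        gcongr
    _ ≤ _ := by
        rw [div_le_div_iff₀ (by positivity) hδ]
        calc _ ≤ ((freq L).card : ℝ) * (2 * ((R + s * R) / L)) ^ 2 := h1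
          _ = _ := by ring

end Density

/-- **Density theorem, interpolating part, on the flat torus.**
If the triangular family `Z(L) = {z L 0, …, z L (m L − 1)}` (with `m L ≤ k_L`) is an
`L²`-interpolating family for the spaces `E_L`, then it is uniformly separated and its
upper Beurling–Landau density is at most `1`. -/
theorem stmt_15 (m : ℝ → ℕ) (z : ℝ → ℕ → T2)
    (hcard : ∀ L : ℝ, 1 ≤ L → m L ≤ kL L)
    (hint : ∀ c : ℝ → ℕ → ℂ,
      (∃ B : ℝ, ∀ L : ℝ, 1 ≤ L →
        (kL L : ℝ)⁻¹ * ∑ j ∈ Finset.range (m L), ‖c L j‖ ^ 2 ≤ B) →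
      ∃ f : ℝ → T2 → ℂ,
        (∀ L : ℝ, 1 ≤ L → f L ∈ EL L) ∧
        (∃ B : ℝ, ∀ L : ℝ, 1 ≤ L → ∫ p : T2, ‖f L p‖ ^ 2 ≤ B) ∧
        (∀ L : ℝ, 1 ≤ L → ∀ j < m L, f L (z L j) = c L j)) :
    -- Z is uniformly separated
    (∃ ε : ℝ, 0 < ε ∧ ∀ L : ℝ, 1 ≤ L → ∀ j < m L, ∀ i < m L, j ≠ i →
      ε / L ≤ dist (z L j) (z L i)) ∧
    -- and D⁺(Z) ≤ 1
    limsup (fun R : ℝ => limsup (fun L : ℝ =>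
        ⨆ ξ : T2,
          (({p | ∃ j < m L, z L j = p} ∩ Metric.ball ξ (R / L)).ncard : ℝ) /
            ((kL L : ℝ) * (volume (Metric.ball ξ (R / L))).toReal)) atTop) atTop ≤ 1 := by
  obtain ⟨C, hC, hunif⟩ := exists_uniform_interpolatesWith hint
  have hsC := Real.sqrt_pos.2 hC
  refine ⟨⟨(2 * Real.sqrt C)⁻¹, by positivity, fun L hL j hj i hi hji =>
    (hunif L hL).le_dist hL hC (Finset.mem_range.2 hj) (Finset.mem_range.2 hi) hji⟩, ?_⟩
  set F : ℝ → ℝ → ℝ := fun R L => ⨆ ξ : T2,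
    (({p | ∃ j < m L, z L j = p} ∩ Metric.ball ξ (R / L)).ncard : ℝ) /
      ((kL L : ℝ) * (volume (Metric.ball ξ (R / L))).toReal) with hF
  have hF0 : ∀ R L, 0 ≤ F R L := fun R L => Real.iSup_nonneg fun ξ => by positivity
  set g : ℝ → ℝ := fun R => (1 + (Real.sqrt R)⁻¹) ^ 2 / (1 - 1600 * C * (Real.sqrt R)⁻¹) with hg
  have hs : Tendsto (fun R : ℝ => (Real.sqrt R)⁻¹) atTop (nhds 0) :=
    tendsto_inv_atTop_zero.comp Real.tendsto_sqrt_atTop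
  have hglim : Tendsto g atTop (nhds 1) := by
    have : Tendsto g atTop (nhds ((1 + 0) ^ 2 / (1 - 1600 * C * 0))) :=
      ((hs.const_add 1).pow 2).div ((hs.const_mul (1600 * C)).const_sub 1) (by norm_num)
    simpa using this
  have hsmall : ∀ᶠ R : ℝ in atTop, 1600 * C * (Real.sqrt R)⁻¹ < 1 := by
    have := hs.const_mul (1600 * C)
    rw [mul_zero] at this
    exact this.eventually_lt_const one_pos
  have hFg : ∀ᶠ R : ℝ in atTop, ∀ᶠ L : ℝ in atTop, F R L ≤ g R := by
    filter_upwards [hsmall, eventually_gt_atTop 0] with R hR1 hR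
    have hR2 := Real.sqrt_pos.2 hR
    have e : (Real.sqrt R)⁻¹ * R = Real.sqrt R := by
      rw [inv_mul_eq_div, Real.div_sqrt]
    filter_upwards [eventually_ge_atTop 1, eventually_ge_atTop (Real.sqrt R),
      eventually_ge_atTop (2 * R)] with L hL hL1 hL2
    refine ciSup_le fun ξ => ?_
    have := (hunif L hL).ncard_div_le hL hC hR (inv_pos.2 hR2)
      (by rw [e, div_eq_mul_inv]; exact hR1) (by rw [e]; exact hL1) hL2 ξ
    rwa [e, div_eq_mul_inv (1600 * C)] at this
  have hcob : ∀ R, IsCoboundedUnder (· ≤ ·) atTop (F R) := fun R =>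
    isCoboundedUnder_le_of_le atTop (hF0 R)
  have hlim : ∀ᶠ R : ℝ in atTop, limsup (F R) atTop ≤ g R :=
    hFg.mono fun R hR => limsup_le_of_le (hcob R) hR
  have hnonneg : ∀ᶠ R : ℝ in atTop, 0 ≤ limsup (F R) atTop :=
    hFg.mono fun R hR => le_limsup_of_frequently_le
      (Frequently.of_forall (hF0 R)) (isBoundedUnder_of_eventually_le hR)
  calc limsup (fun R => limsup (F R) atTop) atTop ≤ limsup g atTop :=
        limsup_le_limsup hlim (isCoboundedUnder_le_of_eventually_le atTop hnonneg)
          hglim.isBoundedUnder_le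
    _ = 1 := hglim.limsup_eq

end
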